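/- arXiv:0809.1182 — 2 statements merged into one kernel-verified Lean document; each statement's English description precedes it below -/
import Mathlib

section
/- A linear map J : u(2) → u(2) has zero torsion if and only if there exist R ∈ SO(3), b > 0, and a 2×2 real matrix (m₃₃, m₃₄; m₄₃, m₄₄) such that, writing Φ = diag(R, b) ∈ Aut(u(2)), the matrix Φ⁻¹ J Φ has rows (0,1,0,0), (−1,0,0,0), (0,0,m₃₃,m₃₄), (0,0,m₄₃,m₄₄). -/
/-- `R` is a special orthogonal 3×3 matrix. -/
def so3 (R : Matrix (Fin 3) (Fin 3) ℝ) : Prop := R * R.transpose = 1 ∧ R.det = 1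

/-- The Lie bracket of u(2) in the basis (J₁,J₂,J₃,J₄): cross product on the first three
coordinates, zero on the central coordinate. -/
def bra4 (x y : Fin 4 → ℝ) : Fin 4 → ℝ :=
  ![x 1 * y 2 - x 2 * y 1, x 2 * y 0 - x 0 * y 2, x 0 * y 1 - x 1 * y 0, 0]

/-- `J` (as a 4×4 matrix in the basis (J₁,J₂,J₃,J₄)) has zero torsion on u(2). -/
def torsion4 (J : Matrix (Fin 4) (Fin 4) ℝ) : Prop :=
  ∀ X Y : Fin 4 → ℝ,
    bra4 (J.mulVec X) (J.mulVec Y) - bra4 X Y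
      - J.mulVec (bra4 (J.mulVec X) Y) - J.mulVec (bra4 X (J.mulVec Y)) = 0

/-- `J` is a complex structure on u(2). -/
def isCx4 (J : Matrix (Fin 4) (Fin 4) ℝ) : Prop := J * J = -1 ∧ torsion4 J

/-- The block-diagonal matrix diag(R, b) ∈ Aut(u(2)). -/
def diag31 (R : Matrix (Fin 3) (Fin 3) ℝ) (b : ℝ) : Matrix (Fin 4) (Fin 4) ℝ :=
  !![R 0 0, R 0 1, R 0 2, 0;
     R 1 0, R 1 1, R 1 2, 0;
     R 2 0, R 2 1, R 2 2, 0;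
     0, 0, 0, b]

open Matrix

/-- The second elementary symmetric function of the eigenvalues of a 3×3 matrix. -/
def secondInvariant (A : Matrix (Fin 3) (Fin 3) ℝ) : ℝ :=
  A 0 0 * A 1 1 - A 0 1 * A 1 0 + (A 0 0 * A 2 2 - A 0 2 * A 2 0)
    + (A 1 1 * A 2 2 - A 1 2 * A 2 1)

lemma adjugate_eq_sq_sub (A : Matrix (Fin 3) (Fin 3) ℝ) :
    A.adjugate = A * A - A.trace • A + secondInvariant A • 1 := by
  rw [adjugate_fin_three]
  ext i j
  fin_cases i <;> fin_cases j <;>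
    simp [secondInvariant, trace, Fin.sum_univ_three, mul_apply] <;> ring

lemma symm_part_mul {A : Matrix (Fin 3) (Fin 3) ℝ}
    (h : A.adjugateᵀ = 1 + A.trace • A - A * Aᵀ) :
    (A + Aᵀ) * (Aᵀ - A.trace • 1) = (1 - secondInvariant A) • 1 := by
  rw [adjugate_eq_sq_sub] at h
  simp only [transpose_add, transpose_sub, transpose_mul, transpose_smul, transpose_one] at h
  simp only [add_mul, mul_sub, sub_smul, one_smul, mul_smul_comm, mul_one]
  rw [← sub_eq_zero, ← sub_eq_zero.2 h]
  module

lemma secondInvariant_eq_one {A : Matrix (Fin 3) (Fin 3) ℝ}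
    (h : A.adjugateᵀ = 1 + A.trace • A - A * Aᵀ) : secondInvariant A = 1 := by
  by_contra hs
  have hc : 1 - secondInvariant A ≠ 0 := fun h0 => hs (by linarith)
  have H1 := symm_part_mul h
  have H2 := congrArg transpose H1
  simp only [transpose_mul, transpose_add, transpose_sub, transpose_smul, transpose_one,
    transpose_transpose] at H2
  rw [add_comm Aᵀ] at H2
  have hsymm : A = Aᵀ := by
    have key : (A - A.trace • 1) * ((A + Aᵀ) * (Aᵀ - A.trace • 1))
        = ((A - A.trace • 1) * (A + Aᵀ)) * (Aᵀ - A.trace • 1) := by rw [Matrix.mul_assoc]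
    rw [H1, H2, mul_smul_comm, smul_mul_assoc, Matrix.mul_one, Matrix.one_mul] at key
    have := smul_right_injective _ hc key
    simpa using this
  have hsq : (2 : ℝ) • (A * A - A.trace • A) = (1 - secondInvariant A) • 1 := by
    rw [← H1, ← hsymm]
    simp only [add_mul, mul_sub, mul_smul_comm, mul_one]
    module
  have htr := congrArg trace hsq
  have hs3 : secondInvariant A = -3 := by
    simp [secondInvariant, trace, Fin.sum_univ_three, mul_apply] at htr ⊢
    linarith
  have hadj : A.adjugate = -1 := by
    have : A * A - A.trace • A = (2 : ℝ) • 1 := by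
      apply smul_right_injective _ (two_ne_zero (α := ℝ))
      simp only
      rw [hsq, hs3, smul_smul]
      norm_num
    rw [adjugate_eq_sq_sub, this, hs3, ← add_smul]
    norm_num
  have hA := mul_adjugate A
  rw [hadj, mul_neg, mul_one] at hA
  have hA' : A = -(A.det • (1 : Matrix (Fin 3) (Fin 3) ℝ)) := by rw [← hA, neg_neg]
  generalize A.det = d at hA'
  rw [hA'] at hs3
  simp [secondInvariant] at hs3
  nlinarith [sq_nonneg d]

/-- The matrix `m n nᵀ - [n]ₓ`. -/
def axialMatrix (m a b c : ℝ) : Matrix (Fin 3) (Fin 3) ℝ :=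
  !![m * a * a, m * a * b + c, m * a * c - b;
     m * b * a - c, m * b * b, m * b * c + a;
     m * c * a + b, m * c * b - a, m * c * c]

lemma exists_eq_axialMatrix {A : Matrix (Fin 3) (Fin 3) ℝ}
    (h : A.adjugateᵀ = 1 + A.trace • A - A * Aᵀ) :
    ∃ m a b c : ℝ, a ^ 2 + b ^ 2 + c ^ 2 = 1 ∧ A = axialMatrix m a b c := by
  obtain ⟨x, y, z, p, q, r, a, b, c, rfl⟩ : ∃ x y z p q r a b c : ℝ,
      A = !![x, r + c, q - b; r - c, y, p + a; q + b, p - a, z] := by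
    refine ⟨A 0 0, A 1 1, A 2 2, (A 1 2 + A 2 1) / 2, (A 2 0 + A 0 2) / 2, (A 0 1 + A 1 0) / 2,
      (A 1 2 - A 2 1) / 2, (A 2 0 - A 0 2) / 2, (A 0 1 - A 1 0) / 2, ?_⟩
    ext i j
    fin_cases i <;> fin_cases j <;> simp <;> ring
  have hs := secondInvariant_eq_one h
  have H1 := symm_part_mul h
  rw [hs, sub_self, zero_smul] at H1
  have e (i j : Fin 3) := congrFun (congrFun H1 i) j
  have e00 := e 0 0
  have e01 := e 0 1
  have e02 := e 0 2
  have e10 := e 1 0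
  have e11 := e 1 1
  have e12 := e 1 2
  have e20 := e 2 0
  have e21 := e 2 1
  have e22 := e 2 2
  clear e
  simp [trace, Fin.sum_univ_three, mul_apply] at e00 e01 e02 e10 e11 e12 e20 e21 e22
  simp [secondInvariant] at hs
  have hunit : a ^ 2 + b ^ 2 + c ^ 2 = 1 := by
    linear_combination hs + (e00 + e11 + e22) / 4
  have hnorm : x ^ 2 + y ^ 2 + z ^ 2 + 2 * (p ^ 2 + q ^ 2 + r ^ 2) = (x + y + z) ^ 2 := by
    linear_combination (e00 + e11 + e22) / 2
  have haxis : x * a ^ 2 + y * b ^ 2 + z * c ^ 2 + 2 * (p * b * c + q * c * a + r * a * b)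
      = x + y + z := by
    linear_combination (a * (e12 - e21) + b * (e20 - e02) + c * (e01 - e10)) / 2
      + (x + y + z) * hunit
  set t := x + y + z with ht
  have hsum : (x - t * a * a) ^ 2 + (y - t * b * b) ^ 2 + (z - t * c * c) ^ 2
      + 2 * ((p - t * b * c) ^ 2 + (q - t * c * a) ^ 2 + (r - t * a * b) ^ 2) = 0 := by
    linear_combination hnorm - 2 * t * haxis + t ^ 2 * (a ^ 2 + b ^ 2 + c ^ 2 + 1) * hunit
  have hxs := sq_nonneg (x - t * a * a)
  have hys := sq_nonneg (y - t * b * b)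
  have hzs := sq_nonneg (z - t * c * c)
  have hps := sq_nonneg (p - t * b * c)
  have hqs := sq_nonneg (q - t * c * a)
  have hrs := sq_nonneg (r - t * a * b)
  have hx0 : x - t * a * a = 0 := sq_eq_zero_iff.1 (by
    linarith only [hsum, hxs, hys, hzs, hps, hqs, hrs])
  have hy0 : y - t * b * b = 0 := sq_eq_zero_iff.1 (by
    linarith only [hsum, hxs, hys, hzs, hps, hqs, hrs])
  have hz0 : z - t * c * c = 0 := sq_eq_zero_iff.1 (by
    linarith only [hsum, hxs, hys, hzs, hps, hqs, hrs])
  have hp0 : p - t * b * c = 0 := sq_eq_zero_iff.1 (by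
    linarith only [hsum, hxs, hys, hzs, hps, hqs, hrs])
  have hq0 : q - t * c * a = 0 := sq_eq_zero_iff.1 (by
    linarith only [hsum, hxs, hys, hzs, hps, hqs, hrs])
  have hr0 : r - t * a * b = 0 := sq_eq_zero_iff.1 (by
    linarith only [hsum, hxs, hys, hzs, hps, hqs, hrs])
  refine ⟨t, a, b, c, hunit, ?_⟩
  ext i j
  fin_cases i <;> fin_cases j <;> simp [axialMatrix] <;>
    linarith only [hx0, hy0, hz0, hp0, hq0, hr0]


lemma cross_eq_zero_of_eigen {m a b c u v w : ℝ} (hn : a ^ 2 + b ^ 2 + c ^ 2 = 1)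
    (horth : a * u + b * v + c * w = 0) (h0 : m * u = c * v - b * w)
    (h1 : m * v = a * w - c * u) (h2 : m * w = b * u - a * v) : u = 0 ∧ v = 0 ∧ w = 0 := by
  have hm : m * (u ^ 2 + v ^ 2 + w ^ 2) = 0 := by
    linear_combination u * h0 + v * h1 + w * h2
  have hsq : u ^ 2 + v ^ 2 + w ^ 2 = 0 := by
    linear_combination m * hm - (m * u + (c * v - b * w)) * h0 - (m * v + (a * w - c * u)) * h1
      - (m * w + (b * u - a * v)) * h2 - (u ^ 2 + v ^ 2 + w ^ 2) * hn
      + (a * u + b * v + c * w) * horth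
  refine ⟨?_, ?_, ?_⟩ <;> rw [← sq_eq_zero_iff] <;>
    nlinarith [sq_nonneg u, sq_nonneg v, sq_nonneg w]

lemma eq_smul_of_cross_eq_zero {a b c x y z : ℝ} (hn : a ^ 2 + b ^ 2 + c ^ 2 = 1)
    (h0 : b * z - c * y = 0) (h1 : c * x - a * z = 0) (h2 : a * y - b * x = 0) :
    ∃ k : ℝ, x = k * a ∧ y = k * b ∧ z = k * c :=
  ⟨a * x + b * y + c * z, by linear_combination -x * hn + c * h1 - b * h2,
    by linear_combination -y * hn + a * h2 - c * h0,
    by linear_combination -z * hn + b * h0 - a * h1⟩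

lemma exists_unit_orthogonal (a b c : ℝ) :
    ∃ u v w : ℝ, u ^ 2 + v ^ 2 + w ^ 2 = 1 ∧ a * u + b * v + c * w = 0 := by
  by_cases h : a ^ 2 + b ^ 2 = 0
  · have ha : a = 0 := by nlinarith
    exact ⟨1, 0, 0, by norm_num, by simp [ha]⟩
  · have hpos : 0 < a ^ 2 + b ^ 2 := lt_of_le_of_ne (by positivity) (Ne.symm h)
    have hs := Real.sq_sqrt hpos.le
    have hs0 : √(a ^ 2 + b ^ 2) ≠ 0 := (Real.sqrt_pos.2 hpos).ne'
    refine ⟨b / √(a ^ 2 + b ^ 2), -a / √(a ^ 2 + b ^ 2), 0, ?_, ?_⟩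
    · field_simp
      rw [hs]
      ring
    · field_simp
      ring

lemma torsion4.exists_axial {J : Matrix (Fin 4) (Fin 4) ℝ} (h : torsion4 J) :
    ∃ m a b c k l d : ℝ, a ^ 2 + b ^ 2 + c ^ 2 = 1 ∧
      J = !![m * a * a, m * a * b + c, m * a * c - b, k * a;
             m * b * a - c, m * b * b, m * b * c + a, k * b;
             m * c * a + b, m * c * b - a, m * c * c, k * c;
             l * a, l * b, l * c, d] := by
  have e (X Y : Fin 4 → ℝ) (i : Fin 4) := congrFun (h X Y) i
  simp only [bra4, mulVec, dotProduct, Fin.sum_univ_four, Pi.sub_apply, Pi.zero_apply] at e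
  have e12 := e ![0, 1, 0, 0] ![0, 0, 1, 0]
  have e20 := e ![0, 0, 1, 0] ![1, 0, 0, 0]
  have e01 := e ![1, 0, 0, 0] ![0, 1, 0, 0]
  obtain ⟨m, a, b, c, hn, hA⟩ := exists_eq_axialMatrix
      (A := J.submatrix Fin.castSucc Fin.castSucc) (by
    rw [adjugate_fin_three]
    have e120 := e12 0
    have e121 := e12 1
    have e122 := e12 2
    have e200 := e20 0
    have e201 := e20 1
    have e202 := e20 2
    have e010 := e01 0
    have e011 := e01 1
    have e012 := e01 2
    simp at e120 e121 e122 e200 e201 e202 e010 e011 e012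
    ext i j
    fin_cases i <;> fin_cases j <;> simp [trace, Fin.sum_univ_three, mul_apply]
    all_goals linarith)
  have hJ (i j : Fin 3) := congrFun (congrFun hA i) j
  simp only [submatrix_apply] at hJ
  have h00 : J 0 0 = m * a * a := hJ 0 0
  have h01 : J 0 1 = m * a * b + c := hJ 0 1
  have h02 : J 0 2 = m * a * c - b := hJ 0 2
  have h10 : J 1 0 = m * b * a - c := hJ 1 0
  have h11 : J 1 1 = m * b * b := hJ 1 1
  have h12 : J 1 2 = m * b * c + a := hJ 1 2
  have h20 : J 2 0 = m * c * a + b := hJ 2 0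
  have h21 : J 2 1 = m * c * b - a := hJ 2 1
  have h22 : J 2 2 = m * c * c := hJ 2 2
  clear hJ hA
  have hv : ∃ k : ℝ, J 0 3 = k * a ∧ J 1 3 = k * b ∧ J 2 3 = k * c := by
    have f := e ![a, b, c, 0] ![0, 0, 0, 1]
    have f0 := f 0
    have f1 := f 1
    have f2 := f 2
    simp [h00, h01, h02, h10, h11, h12, h20, h21, h22] at f0 f1 f2
    generalize J 0 3 = x at *
    generalize J 1 3 = y at *
    generalize J 2 3 = z at *
    obtain ⟨h0, h1, h2⟩ := cross_eq_zero_of_eigen (m := m) (u := b * z - c * y)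
      (v := c * x - a * z) (w := a * y - b * x) hn (by ring)
      (by linear_combination f0 - m * (b * z - c * y) * hn)
      (by linear_combination f1 - m * (c * x - a * z) * hn)
      (by linear_combination f2 - m * (a * y - b * x) * hn)
    exact eq_smul_of_cross_eq_zero hn h0 h1 h2
  have hw : ∃ l : ℝ, J 3 0 = l * a ∧ J 3 1 = l * b ∧ J 3 2 = l * c := by
    have f0 := e12 3
    have f1 := e20 3
    have f2 := e01 3
    simp [h00, h01, h02, h10, h11, h12, h20, h21, h22] at f0 f1 f2
    generalize J 3 0 = x at *
    generalize J 3 1 = y at *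
    generalize J 3 2 = z at *
    obtain ⟨h0, h1, h2⟩ := cross_eq_zero_of_eigen (m := m) (u := b * z - c * y)
      (v := c * x - a * z) (w := a * y - b * x) hn (by ring)
      (by linear_combination c * f1 - b * f2 - m * (b * z - c * y) * hn)
      (by linear_combination a * f2 - c * f0 - m * (c * x - a * z) * hn)
      (by linear_combination b * f0 - a * f1 - m * (a * y - b * x) * hn)
    exact eq_smul_of_cross_eq_zero hn h0 h1 h2
  obtain ⟨k, hk0, hk1, hk2⟩ := hv
  obtain ⟨l, hl0, hl1, hl2⟩ := hw
  refine ⟨m, a, b, c, k, l, J 3 3, hn, ?_⟩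
  ext i j
  fin_cases i <;> fin_cases j <;> simp [*]

lemma so3.adjugate_eq {R : Matrix (Fin 3) (Fin 3) ℝ} (h : so3 R) : R.adjugate = Rᵀ := by
  have := congrArg (R.adjugate * ·) h.1
  simp only [← Matrix.mul_assoc, adjugate_mul, h.2] at this
  simpa using this.symm

lemma diag31_mul_transpose {R : Matrix (Fin 3) (Fin 3) ℝ} (h : so3 R) {b : ℝ} (hb : b ≠ 0) :
    diag31 R b * diag31 Rᵀ b⁻¹ = 1 := by
  have e (i j : Fin 3) := congrFun (congrFun h.1 i) j
  simp only [mul_apply, Fin.sum_univ_three, transpose_apply] at e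
  ext i j
  fin_cases i <;> fin_cases j <;> simp [diag31, mul_apply, Fin.sum_univ_four, e, hb]

lemma bra4_diag31 {R : Matrix (Fin 3) (Fin 3) ℝ} (h : so3 R) (b : ℝ) (x y : Fin 4 → ℝ) :
    bra4 (diag31 R b *ᵥ x) (diag31 R b *ᵥ y) = diag31 R b *ᵥ bra4 x y := by
  have hadj := h.adjugate_eq
  rw [adjugate_fin_three] at hadj
  have e (i j : Fin 3) := (congrFun (congrFun hadj j) i).symm
  simp only [transpose_apply] at e
  have e00 := e 0 0
  have e01 := e 0 1
  have e02 := e 0 2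
  have e10 := e 1 0
  have e11 := e 1 1
  have e12 := e 1 2
  have e20 := e 2 0
  have e21 := e 2 1
  have e22 := e 2 2
  clear e hadj
  simp at e00 e01 e02 e10 e11 e12 e20 e21 e22
  ext i
  fin_cases i <;> simp [bra4, diag31, mulVec, dotProduct, Fin.sum_univ_four]
  · linear_combination -(x 1 * y 2 - x 2 * y 1) * e00 - (x 2 * y 0 - x 0 * y 2) * e01
      - (x 0 * y 1 - x 1 * y 0) * e02
  · linear_combination -(x 1 * y 2 - x 2 * y 1) * e10 - (x 2 * y 0 - x 0 * y 2) * e11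
      - (x 0 * y 1 - x 1 * y 0) * e12
  · linear_combination -(x 1 * y 2 - x 2 * y 1) * e20 - (x 2 * y 0 - x 0 * y 2) * e21
      - (x 0 * y 1 - x 1 * y 0) * e22

/-- Zero torsion is transported by an invertible intertwiner that preserves the bracket. -/
lemma torsion4.of_intertwining {J M Φ Ψ : Matrix (Fin 4) (Fin 4) ℝ} (hM : torsion4 M)
    (hΦ : ∀ x y, bra4 (Φ *ᵥ x) (Φ *ᵥ y) = Φ *ᵥ bra4 x y) (hinv : Φ * Ψ = 1)
    (hJ : J * Φ = Φ * M) : torsion4 J := by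
  intro X Y
  have hX : X = Φ *ᵥ (Ψ *ᵥ X) := by rw [mulVec_mulVec, hinv, one_mulVec]
  have hY : Y = Φ *ᵥ (Ψ *ᵥ Y) := by rw [mulVec_mulVec, hinv, one_mulVec]
  have hJΦ (x : Fin 4 → ℝ) : J *ᵥ (Φ *ᵥ x) = Φ *ᵥ (M *ᵥ x) := by
    rw [mulVec_mulVec, hJ, mulVec_mulVec]
  rw [hX, hY]
  simp only [hJΦ, hΦ, ← mulVec_sub]
  rw [hM, mulVec_zero]

lemma torsion4_normalForm (m33 m34 m43 m44 : ℝ) :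
    torsion4 !![0, 1, 0, 0; -1, 0, 0, 0; 0, 0, m33, m34; 0, 0, m43, m44] := by
  intro X Y
  ext i
  simp only [bra4, mulVec, dotProduct, Fin.sum_univ_four, Pi.sub_apply]
  fin_cases i <;> simp <;> ring

/-- A linear map `J : u(2) → u(2)` has zero torsion iff there are `R ∈ SO(3)`, `b > 0` and a
2×2 real matrix `(m₃₃,m₃₄;m₄₃,m₄₄)` such that `Φ⁻¹ J Φ`, `Φ = diag(R,b)`, has rows
(0,1,0,0), (−1,0,0,0), (0,0,m₃₃,m₃₄), (0,0,m₄₃,m₄₄). -/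
theorem stmt3 (J : Matrix (Fin 4) (Fin 4) ℝ) :
    torsion4 J ↔
      ∃ (R : Matrix (Fin 3) (Fin 3) ℝ) (b m33 m34 m43 m44 : ℝ), so3 R ∧ 0 < b ∧
        (diag31 R b)⁻¹ * J * diag31 R b =
          !![0, 1, 0, 0; -1, 0, 0, 0; 0, 0, m33, m34; 0, 0, m43, m44] := by
  constructor
  · intro h
    obtain ⟨m, a, b, c, k, l, d, hn, rfl⟩ := h.exists_axial
    obtain ⟨u, v, w, hu, huv⟩ := exists_unit_orthogonal a b c
    have hR : so3 !![u, b * w - c * v, a; v, c * u - a * w, b; w, a * v - b * u, c] := by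
      constructor
      · rw [mul_eq_one_comm]
        ext i j
        fin_cases i <;> fin_cases j <;> simp [mul_apply, Fin.sum_univ_three]
        · linear_combination hu
        · ring
        · linear_combination huv
        · ring
        · linear_combination (u ^ 2 + v ^ 2 + w ^ 2) * hn + hu - (a * u + b * v + c * w) * huv
        · ring
        · linear_combination huv
        · ring
        · linear_combination hn
      · simp [det_fin_three]
        linear_combination (u ^ 2 + v ^ 2 + w ^ 2) * hn + hu - (a * u + b * v + c * w) * huv
    refine ⟨_, 1, m, k, l, d, hR, one_pos, ?_⟩
    have hinv := diag31_mul_transpose hR one_ne_zero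
    have hdet := isUnit_det_of_right_inverse hinv
    rw [Matrix.mul_assoc]
    refine (congrArg _ ?_).trans (nonsing_inv_mul_cancel_left _ _ hdet)
    ext i j
    fin_cases i <;> fin_cases j <;> simp [diag31, mul_apply, Fin.sum_univ_four]
    · linear_combination m * a * huv
    · linear_combination u * hn - a * huv
    · linear_combination m * a * hn
    · ring
    · linear_combination m * b * huv
    · linear_combination v * hn - b * huv
    · linear_combination m * b * hn
    · ring
    · linear_combination m * c * huv
    · linear_combination w * hn - c * huv
    · linear_combination m * c * hn
    · ring
    · linear_combination l * huv
    · ring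
    · linear_combination l * hn
  · rintro ⟨R, b, m33, m34, m43, m44, hR, hb, h⟩
    have hinv := diag31_mul_transpose hR hb.ne'
    have hdet := isUnit_det_of_right_inverse hinv
    refine (torsion4_normalForm m33 m34 m43 m44).of_intertwining (bra4_diag31 hR b) hinv ?_
    rw [← h, Matrix.mul_assoc, mul_nonsing_inv_cancel_left _ _ hdet]
end

section
/- Let X ⊂ ℝ¹⁶ be the set of 4×4 real matrices that are complex structures on u(2). For J = (aⁱⱼ) ∈ X one has ((a¹₄)² + (a²₄)² + (a³₄)²) ≠ 0; define c(J) = (a³₄(a¹₂−a²₁) + a²₄(a³₁−a¹₃) + a¹₄(a²₃−a³₂)) / (2((a¹₄)² + (a²₄)² + (a³₄)²)). Then c(J) ≠ 0 for all J ∈ X; the sets X⁺ = {J ∈ X : c(J) > 0} and X⁻ = {J ∈ X : c(J) < 0} are disjoint with union X, each is closed in ℝ¹⁶, and each, with the subspace topology, is homeomorphic to ℝ × (ℝ³ ∖ {0}). -/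
/-- The set of complex structures on u(2), as a subset of the 4×4 real matrices ≅ ℝ¹⁶. -/
def X4 : Set (Matrix (Fin 4) (Fin 4) ℝ) := {A | isCx4 A}

/-- The quantity c(J) (indices: aⁱⱼ = A (i-1) (j-1)). -/
noncomputable def cmap (A : Matrix (Fin 4) (Fin 4) ℝ) : ℝ :=
  (A 2 3 * (A 0 1 - A 1 0) + A 1 3 * (A 2 0 - A 0 2) + A 0 3 * (A 1 2 - A 2 1)) /
    (2 * ((A 0 3) ^ 2 + (A 1 3) ^ 2 + (A 2 3) ^ 2))

/-- The part of `X4` where `c > 0`. -/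
noncomputable def X4p : Set (Matrix (Fin 4) (Fin 4) ℝ) := {A ∈ X4 | 0 < cmap A}

/-- The part of `X4` where `c < 0`. -/
noncomputable def X4m : Set (Matrix (Fin 4) (Fin 4) ℝ) := {A ∈ X4 | cmap A < 0}


/-- The squared length of a vector of `ℝ³`. -/
def normSq3 (v : Fin 3 → ℝ) : ℝ := v 0 ^ 2 + v 1 ^ 2 + v 2 ^ 2

lemma normSq3_pos {v : Fin 3 → ℝ} (hv : v ≠ 0) : 0 < normSq3 v := by
  have hcoord : v 0 ≠ 0 ∨ v 1 ≠ 0 ∨ v 2 ≠ 0 := by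
    by_contra! h
    exact hv (by ext i; fin_cases i <;> simp [h])
  unfold normSq3
  rcases hcoord with h | h | h <;> positivity

/-- The first three coordinates of the last column of `A`. -/
def colVec (A : Matrix (Fin 4) (Fin 4) ℝ) : Fin 3 → ℝ := ![A 0 3, A 1 3, A 2 3]

/-- The matrix sending `J₄` to `v + d J₄`, acting as `-c v ×` on the plane orthogonal to `v`;
it is a complex structure when `c ^ 2 * ‖v‖ ^ 2 = 1`. -/
def cxMatrix (c d : ℝ) (v : Fin 3 → ℝ) : Matrix (Fin 4) (Fin 4) ℝ :=
  !![-d * c ^ 2 * v 0 * v 0, c * v 2 - d * c ^ 2 * v 0 * v 1,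
      -c * v 1 - d * c ^ 2 * v 0 * v 2, v 0;
    -c * v 2 - d * c ^ 2 * v 1 * v 0, -d * c ^ 2 * v 1 * v 1,
      c * v 0 - d * c ^ 2 * v 1 * v 2, v 1;
    c * v 1 - d * c ^ 2 * v 2 * v 0, -c * v 0 - d * c ^ 2 * v 2 * v 1,
      -d * c ^ 2 * v 2 * v 2, v 2;
    -(1 + d ^ 2) * c ^ 2 * v 0, -(1 + d ^ 2) * c ^ 2 * v 1, -(1 + d ^ 2) * c ^ 2 * v 2, d]

lemma colVec_cxMatrix (c d : ℝ) (v : Fin 3 → ℝ) : colVec (cxMatrix c d v) = v := by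
  ext i; fin_cases i <;> simp [colVec, cxMatrix]

lemma cxMatrix_three_three (c d : ℝ) (v : Fin 3 → ℝ) : cxMatrix c d v 3 3 = d := by
  simp [cxMatrix]

lemma cmap_cxMatrix {c : ℝ} (d : ℝ) {v : Fin 3 → ℝ} (hv : normSq3 v ≠ 0) :
    cmap (cxMatrix c d v) = c := by
  unfold normSq3 at hv
  simp only [cmap, cxMatrix, Matrix.of_apply, Matrix.cons_val]
  field_simp
  ring

lemma mulVec_four_apply (A : Matrix (Fin 4) (Fin 4) ℝ) (x : Fin 4 → ℝ) (i : Fin 4) :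
    A.mulVec x i = A i 0 * x 0 + A i 1 * x 1 + A i 2 * x 2 + A i 3 * x 3 := by
  simp [Matrix.mulVec, dotProduct, Fin.sum_univ_four]

lemma cxMatrix_mem_X4 {c : ℝ} (d : ℝ) {v : Fin 3 → ℝ} (h : c ^ 2 * normSq3 v = 1) :
    cxMatrix c d v ∈ X4 := by
  unfold normSq3 at h
  refine ⟨?_, fun X Y => ?_⟩
  · ext i j
    fin_cases i <;> fin_cases j <;>
      simp [cxMatrix, Matrix.mul_apply, Fin.sum_univ_four] <;> grind
  · ext i
    simp only [Pi.sub_apply, mulVec_four_apply, bra4, Pi.zero_apply]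
    fin_cases i <;>
      simp only [cxMatrix, Matrix.of_apply, Matrix.cons_val, Fin.zero_eta, Fin.mk_one,
        Fin.reduceFinMk] <;> grind

/-- A symmetric `3 × 3` matrix commuting with `v ×`, having `v` as an eigenvector of eigenvalue
`-d` and trace `-d`, is `-d` times the orthogonal projection on `v`. -/
lemma symm_eq_of_commute_cross {a b e f g h x y z d : ℝ}
    (t00 : f * z - g * y = 0) (t11 : h * x - f * z = 0)
    (t01 : g * x - a * z + b * z - h * y = 0)
    (t02 : a * y - f * x + h * z - e * y = 0)
    (t12 : f * y - b * x - g * z + e * x = 0)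
    (s0 : a * x + f * y + g * z + x * d = 0)
    (s1 : f * x + b * y + h * z + y * d = 0)
    (s2 : g * x + h * y + e * z + z * d = 0)
    (htr : a + b + e = -d) :
    (x ^ 2 + y ^ 2 + z ^ 2) * a = -d * x * x ∧ (x ^ 2 + y ^ 2 + z ^ 2) * b = -d * y * y ∧
    (x ^ 2 + y ^ 2 + z ^ 2) * e = -d * z * z ∧ (x ^ 2 + y ^ 2 + z ^ 2) * f = -d * x * y ∧
    (x ^ 2 + y ^ 2 + z ^ 2) * g = -d * x * z ∧ (x ^ 2 + y ^ 2 + z ^ 2) * h = -d * y * z := by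
  refine ⟨?_, ?_, ?_, ?_, ?_, ?_⟩ <;> grind

/-- A vector `(p, q, r)` whose cross product with `(x, y, z) ≠ 0` vanishes is a multiple of it. -/
lemma smul_eq_of_cross_eq_zero {x y z p q r k : ℝ} (hN : x ^ 2 + y ^ 2 + z ^ 2 ≠ 0)
    (h0 : q * z - r * y = 0) (h1 : r * x - p * z = 0) (h2 : p * y - q * x = 0)
    (hk : k * (x ^ 2 + y ^ 2 + z ^ 2) = p * x + q * y + r * z) :
    p = k * x ∧ q = k * y ∧ r = k * z := by
  refine ⟨?_, ?_, ?_⟩ <;> apply mul_left_cancel₀ hN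
  · linear_combination -z * h1 + y * h2 - x * hk
  · linear_combination z * h0 - x * h2 - y * hk
  · linear_combination -y * h0 + x * h1 - z * hk

/-- The entries of a complex structure with upper left block `(aᵢⱼ)`, last column `(x, y, z, d)` and
last row `(p, q, r, d)`: the `sᵢⱼ` say that its square is `-1`, the `tᵢⱼ` that the torsion of
`(Jᵢ, J₄)` vanishes. -/
lemma cx_entries {a00 a01 a02 a10 a11 a12 a20 a21 a22 x y z p q r d c : ℝ}
    (s00 : a00 * a00 + a01 * a10 + a02 * a20 + x * p = -1)
    (s01 : a00 * a01 + a01 * a11 + a02 * a21 + x * q = 0)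
    (s02 : a00 * a02 + a01 * a12 + a02 * a22 + x * r = 0)
    (s03 : a00 * x + a01 * y + a02 * z + x * d = 0)
    (s10 : a10 * a00 + a11 * a10 + a12 * a20 + y * p = 0)
    (s11 : a10 * a01 + a11 * a11 + a12 * a21 + y * q = -1)
    (s12 : a10 * a02 + a11 * a12 + a12 * a22 + y * r = 0)
    (s13 : a10 * x + a11 * y + a12 * z + y * d = 0)
    (s20 : a20 * a00 + a21 * a10 + a22 * a20 + z * p = 0)
    (s21 : a20 * a01 + a21 * a11 + a22 * a21 + z * q = 0)
    (s22 : a20 * a02 + a21 * a12 + a22 * a22 + z * r = -1)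
    (s23 : a20 * x + a21 * y + a22 * z + z * d = 0)
    (s33 : p * x + q * y + r * z + d * d = -1)
    (t00 : a10 * z - a20 * y - (-(a01 * z) + a02 * y) = 0)
    (t01 : a20 * x - a00 * z - (-(a11 * z) + a12 * y) = 0)
    (t02 : a00 * y - a10 * x - (-(a21 * z) + a22 * y) = 0)
    (t03 : -(r * y) + q * z = 0)
    (t10 : a11 * z - a21 * y - (a00 * z + -(a02 * x)) = 0)
    (t11 : a21 * x - a01 * z - (a10 * z + -(a12 * x)) = 0)
    (t12 : a01 * y - a11 * x - (a20 * z + -(a22 * x)) = 0)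
    (t13 : r * x + -(p * z) = 0)
    (t20 : a12 * z - a22 * y - (-(a00 * y) + a01 * x) = 0)
    (t21 : a22 * x - a02 * z - (-(a10 * y) + a11 * x) = 0)
    (t23 : -(q * x) + p * y = 0)
    (hN : 0 < x ^ 2 + y ^ 2 + z ^ 2)
    (hc : c * (2 * (x ^ 2 + y ^ 2 + z ^ 2)) =
      z * (a01 - a10) + y * (a20 - a02) + x * (a12 - a21)) :
    c ^ 2 * (x ^ 2 + y ^ 2 + z ^ 2) = 1 ∧
    (a00 = -d * c ^ 2 * x * x ∧ a01 = c * z - d * c ^ 2 * x * y ∧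
      a02 = -c * y - d * c ^ 2 * x * z) ∧
    (a10 = -c * z - d * c ^ 2 * y * x ∧ a11 = -d * c ^ 2 * y * y ∧
      a12 = c * x - d * c ^ 2 * y * z) ∧
    (a20 = c * y - d * c ^ 2 * z * x ∧ a21 = -c * x - d * c ^ 2 * z * y ∧
      a22 = -d * c ^ 2 * z * z) ∧
    p = -(1 + d ^ 2) * c ^ 2 * x ∧ q = -(1 + d ^ 2) * c ^ 2 * y ∧
    r = -(1 + d ^ 2) * c ^ 2 * z := by
  obtain ⟨u0, u1, u2⟩ := smul_eq_of_cross_eq_zero (p := a12 - a21) (q := a20 - a02)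
    (r := a01 - a10) (k := 2 * c) hN.ne' (by linarith) (by linarith) (by linarith) (by linarith)
  obtain ⟨f, hf⟩ : ∃ f, f = a10 + c * z := ⟨_, rfl⟩
  obtain ⟨g, hg⟩ : ∃ g, g = a02 + c * y := ⟨_, rfl⟩
  obtain ⟨h, hh⟩ : ∃ h, h = a21 + c * x := ⟨_, rfl⟩
  obtain rfl : a01 = f + c * z := by linarith
  obtain rfl : a10 = f - c * z := by linarith
  obtain rfl : a02 = g - c * y := by linarith
  obtain rfl : a20 = g + c * y := by linarith
  obtain rfl : a21 = h - c * x := by linarith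
  obtain rfl : a12 = h + c * x := by linarith
  clear u0 u1 u2 hf hg hh hc
  have hc0 : c ≠ 0 := by
    rintro rfl
    have hyz : 0 ≤ -(y ^ 2 + z ^ 2) := by
      calc 0 ≤ (-f * z + g * y) ^ 2 + (-a11 * z + h * y) ^ 2 + (-h * z + a22 * y) ^ 2 := by
            positivity
        _ = _ := by linear_combination z ^ 2 * s11 - y * z * (s12 + s21) + y ^ 2 * s22
    have hxz : 0 ≤ -(x ^ 2 + z ^ 2) := by
      calc 0 ≤ (-a00 * z + g * x) ^ 2 + (-f * z + h * x) ^ 2 + (-g * z + a22 * x) ^ 2 := by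
            positivity
        _ = _ := by linear_combination z ^ 2 * s00 - x * z * (s02 + s20) + x ^ 2 * s22
    nlinarith [sq_nonneg x, sq_nonneg y, sq_nonneg z]
  have htr : a00 + a11 + a22 = -d := by
    have hz : 2 * c * z * (a00 + a11 + a22 + d) = 0 := by
      linear_combination s01 - s10 + t23 + 2 * c * s23
    have hy : 2 * c * y * (a00 + a11 + a22 + d) = 0 := by
      linear_combination s20 - s02 + t13 + 2 * c * s13
    have hx : 2 * c * x * (a00 + a11 + a22 + d) = 0 := by
      linear_combination s12 - s21 + t03 + 2 * c * s03
    have : 2 * c * (x ^ 2 + y ^ 2 + z ^ 2) * (a00 + a11 + a22 + d) = 0 := by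
      linear_combination x * hx + y * hy + z * hz
    have := (mul_eq_zero.mp this).resolve_left (by positivity)
    linarith
  obtain ⟨S00, S11, S22, S01, S02, S12⟩ :=
    symm_eq_of_commute_cross (a := a00) (b := a11) (e := a22) (f := f) (g := g) (h := h)
      (x := x) (y := y) (z := z) (d := d) (by linarith) (by linarith) (by linarith) (by linarith)
      (by linarith) (by linarith) (by linarith) (by linarith) htr
  have hS : a00 ^ 2 + a11 ^ 2 + a22 ^ 2 + 2 * (f ^ 2 + g ^ 2 + h ^ 2) = d ^ 2 := by
    apply mul_left_cancel₀ hN.ne'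
    linear_combination a00 * S00 + a11 * S11 + a22 * S22 + 2 * (f * S01 + g * S02 + h * S12)
      - d * (x * s03 + y * s13 + z * s23)
  have hcN : c ^ 2 * (x ^ 2 + y ^ 2 + z ^ 2) = 1 := by
    linear_combination (hS + s33 - s00 - s11 - s22) / 2
  obtain ⟨hp, hq, hr⟩ := smul_eq_of_cross_eq_zero (p := p) (q := q) (r := r)
    (k := -(1 + d ^ 2) * c ^ 2) hN.ne' (by linarith) (by linarith) (by linarith)
    (by linear_combination -(1 + d ^ 2) * hcN - s33)
  refine ⟨hcN, ⟨?_, ?_, ?_⟩, ⟨?_, ?_, ?_⟩, ⟨?_, ?_, ?_⟩, hp, hq, hr⟩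
  · linear_combination c ^ 2 * S00 - a00 * hcN
  · linear_combination c ^ 2 * S01 - f * hcN
  · linear_combination c ^ 2 * S02 - g * hcN
  · linear_combination c ^ 2 * S01 - f * hcN
  · linear_combination c ^ 2 * S11 - a11 * hcN
  · linear_combination c ^ 2 * S12 - h * hcN
  · linear_combination c ^ 2 * S02 - g * hcN
  · linear_combination c ^ 2 * S12 - h * hcN
  · linear_combination c ^ 2 * S22 - a22 * hcN

lemma normSq3_colVec_pos {A : Matrix (Fin 4) (Fin 4) ℝ} (hA : A ∈ X4) :
    0 < normSq3 (colVec A) := by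
  refine normSq3_pos fun h => ?_
  have h0 : A 0 3 = 0 := congrFun h 0
  have h1 : A 1 3 = 0 := congrFun h 1
  have h2 : A 2 3 = 0 := congrFun h 2
  have h33 := congrFun (congrFun hA.1 3) 3
  simp only [Matrix.mul_apply, Fin.sum_univ_four, Matrix.neg_apply, Matrix.one_apply_eq,
    h0, h1, h2] at h33
  nlinarith [mul_self_nonneg (A 3 3)]

lemma eq_cxMatrix_of_mem_X4 {A : Matrix (Fin 4) (Fin 4) ℝ} (hA : A ∈ X4) :
    cmap A ^ 2 * normSq3 (colVec A) = 1 ∧ A = cxMatrix (cmap A) (A 3 3) (colVec A) := by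
  have hpos := normSq3_colVec_pos hA
  obtain ⟨hsq, htor⟩ := hA
  have sq (i j) := congrFun (congrFun hsq i) j
  have tor (i j : Fin 4) := congrFun (htor (Pi.single i 1) (Pi.single 3 1)) j
  simp only [Matrix.mul_apply, Fin.sum_univ_four, Matrix.neg_apply] at sq
  simp only [Pi.sub_apply, mulVec_four_apply, bra4, Pi.zero_apply, Matrix.cons_val] at tor
  have s00 := sq 0 0
  have s01 := sq 0 1
  have s02 := sq 0 2
  have s03 := sq 0 3
  have s10 := sq 1 0
  have s11 := sq 1 1
  have s12 := sq 1 2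
  have s13 := sq 1 3
  have s20 := sq 2 0
  have s21 := sq 2 1
  have s22 := sq 2 2
  have s23 := sq 2 3
  have s33 := sq 3 3
  have t00 := tor 0 0
  have t01 := tor 0 1
  have t02 := tor 0 2
  have t03 := tor 0 3
  have t10 := tor 1 0
  have t11 := tor 1 1
  have t12 := tor 1 2
  have t13 := tor 1 3
  have t20 := tor 2 0
  have t21 := tor 2 1
  have t23 := tor 2 3
  clear sq tor hsq htor
  simp at *
  have hN : 0 < A 0 3 ^ 2 + A 1 3 ^ 2 + A 2 3 ^ 2 := hpos
  have hc : cmap A * (2 * (A 0 3 ^ 2 + A 1 3 ^ 2 + A 2 3 ^ 2)) =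
      A 2 3 * (A 0 1 - A 1 0) + A 1 3 * (A 2 0 - A 0 2) + A 0 3 * (A 1 2 - A 2 1) :=
    div_mul_cancel₀ _ (by positivity)
  obtain ⟨hcN, ⟨h00, h01, h02⟩, ⟨h10, h11, h12⟩, ⟨h20, h21, h22⟩, h30, h31, h32⟩ :=
    cx_entries s00 s01 s02 s03 s10 s11 s12 s13 s20 s21 s22 s23 s33
      t00 t01 t02 t03 t10 t11 t12 t13 t20 t21 t23 hN hc
  refine ⟨hcN, ?_⟩
  ext i j
  fin_cases i <;> fin_cases j
  exacts [h00, h01, h02, rfl, h10, h11, h12, rfl, h20, h21, h22, rfl, h30, h31, h32, rfl]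

lemma cmap_ne_zero {A : Matrix (Fin 4) (Fin 4) ℝ} (hA : A ∈ X4) : cmap A ≠ 0 := by
  intro h
  simpa [h] using (eq_cxMatrix_of_mem_X4 hA).1

lemma continuous_colVec : Continuous colVec := by
  unfold colVec
  fun_prop

lemma continuous_bra4 : Continuous fun p : (Fin 4 → ℝ) × (Fin 4 → ℝ) => bra4 p.1 p.2 := by
  unfold bra4
  fun_prop

lemma isClosed_X4 : IsClosed X4 := by
  have h : X4 = {A | A * A = -1} ∩ ⋂ (X : Fin 4 → ℝ) (Y : Fin 4 → ℝ),
      {A | bra4 (A.mulVec X) (A.mulVec Y) - bra4 X Y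
        - A.mulVec (bra4 (A.mulVec X) Y) - A.mulVec (bra4 X (A.mulVec Y)) = 0} := by
    ext A
    simp [X4, isCx4, torsion4]
  rw [h]
  refine (isClosed_eq (by fun_prop) continuous_const).inter
    (isClosed_iInter fun X => isClosed_iInter fun Y => isClosed_eq ?_ continuous_const)
  have hm (Z : Fin 4 → ℝ) : Continuous fun A : Matrix (Fin 4) (Fin 4) ℝ => A.mulVec Z :=
    continuous_id.matrix_mulVec continuous_const
  exact (((continuous_bra4.comp ((hm X).prodMk (hm Y))).sub continuous_const).sub
    (continuous_id.matrix_mulVec (continuous_bra4.comp ((hm X).prodMk continuous_const)))).sub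
    (continuous_id.matrix_mulVec (continuous_bra4.comp (continuous_const.prodMk (hm Y))))

/-- The part of `X4` on which `cmap` has the sign of `ε`. -/
def signPart (ε : ℝ) : Set (Matrix (Fin 4) (Fin 4) ℝ) := {A ∈ X4 | 0 < ε * cmap A}

lemma X4p_eq_signPart : X4p = signPart 1 := by
  ext A; simp [X4p, signPart]

lemma X4m_eq_signPart : X4m = signPart (-1) := by
  ext A; simp [X4m, signPart]

lemma isClosed_signPart {ε : ℝ} (hε : ε ≠ 0) : IsClosed (signPart ε) := by
  have h : signPart ε = X4 ∩ {A | 0 ≤ ε * (A 2 3 * (A 0 1 - A 1 0) + A 1 3 * (A 2 0 - A 0 2)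
      + A 0 3 * (A 1 2 - A 2 1))} := by
    ext A
    refine and_congr_right fun hA => ?_
    have hN : 0 < 2 * (A 0 3 ^ 2 + A 1 3 ^ 2 + A 2 3 ^ 2) :=
      mul_pos two_pos (normSq3_colVec_pos hA)
    have hne : ε * cmap A ≠ 0 := mul_ne_zero hε (cmap_ne_zero hA)
    rw [← hne.symm.le_iff_lt, cmap, ← mul_div_assoc, le_div_iff₀ hN, zero_mul]
    rfl
  rw [h]
  exact isClosed_X4.inter (isClosed_le continuous_const (by fun_prop))

/-- The value of `cmap` on the complex structures with sign `ε` and last column `(v, d)`. -/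
noncomputable def signedInvNorm (ε : ℝ) (v : Fin 3 → ℝ) : ℝ := ε * (√(normSq3 v))⁻¹

lemma signedInvNorm_sq_mul {ε : ℝ} (hε : ε ^ 2 = 1) {v : Fin 3 → ℝ} (hv : v ≠ 0) :
    signedInvNorm ε v ^ 2 * normSq3 v = 1 := by
  have h := normSq3_pos hv
  rw [signedInvNorm, mul_pow, hε, inv_pow, Real.sq_sqrt h.le, one_mul, inv_mul_cancel₀ h.ne']

lemma mul_signedInvNorm_pos {ε : ℝ} (hε : ε ^ 2 = 1) {v : Fin 3 → ℝ} (hv : v ≠ 0) :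
    0 < ε * signedInvNorm ε v := by
  have h := Real.sqrt_pos.mpr (normSq3_pos hv)
  rw [signedInvNorm, ← mul_assoc, ← sq, hε, one_mul]
  exact inv_pos.mpr h

lemma colVec_ne_zero {A : Matrix (Fin 4) (Fin 4) ℝ} (hA : A ∈ X4) : colVec A ≠ 0 := by
  intro h
  simpa [h, normSq3] using normSq3_colVec_pos hA

lemma cmap_eq_signedInvNorm {ε : ℝ} (hε : ε ^ 2 = 1) {A : Matrix (Fin 4) (Fin 4) ℝ}
    (hA : A ∈ signPart ε) : cmap A = signedInvNorm ε (colVec A) := by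
  have hv := colVec_ne_zero hA.1
  have h1 := (eq_cxMatrix_of_mem_X4 hA.1).1
  have h2 := signedInvNorm_sq_mul hε hv
  have hsq : (ε * cmap A) ^ 2 = (ε * signedInvNorm ε (colVec A)) ^ 2 := by
    rw [mul_pow, mul_pow, mul_right_cancel₀ (normSq3_pos hv).ne' (h1.trans h2.symm)]
  have hε0 : ε ≠ 0 := by rintro rfl; norm_num at hε
  exact mul_left_cancel₀ hε0
    ((pow_left_inj₀ hA.2.le (mul_signedInvNorm_pos hε hv).le two_ne_zero).mp hsq)

lemma continuous_normSq3 : Continuous normSq3 := by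
  unfold normSq3
  fun_prop

lemma continuous_cxMatrix :
    Continuous fun q : ℝ × ℝ × (Fin 3 → ℝ) => cxMatrix q.1 q.2.1 q.2.2 := by
  refine continuous_matrix fun i j => ?_
  fin_cases i <;> fin_cases j <;>
    simp only [cxMatrix, Matrix.of_apply, Matrix.cons_val, Fin.zero_eta, Fin.mk_one,
      Fin.reduceFinMk] <;> fun_prop

/-- A complex structure with sign `ε` is determined by its last column. -/
noncomputable def signPartHomeomorph {ε : ℝ} (hε : ε ^ 2 = 1) :
    ↥(signPart ε) ≃ₜ ℝ × {v : Fin 3 → ℝ // v ≠ 0} where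
  toFun A := (A.1 3 3, ⟨colVec A.1, colVec_ne_zero A.2.1⟩)
  invFun p := ⟨cxMatrix (signedInvNorm ε p.2.1) p.1 p.2.1,
    cxMatrix_mem_X4 p.1 (signedInvNorm_sq_mul hε p.2.2), by
      rw [cmap_cxMatrix p.1 (normSq3_pos p.2.2).ne']
      exact mul_signedInvNorm_pos hε p.2.2⟩
  left_inv A := by
    apply Subtype.ext
    change cxMatrix (signedInvNorm ε (colVec A.1)) (A.1 3 3) (colVec A.1) = A.1
    rw [← cmap_eq_signedInvNorm hε A.2]
    exact (eq_cxMatrix_of_mem_X4 A.2.1).2.symm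
  right_inv p := by
    simp only [cxMatrix_three_three, colVec_cxMatrix]
  continuous_toFun :=
    (continuous_subtype_val.matrix_elem 3 3).prodMk
      ((continuous_colVec.comp continuous_subtype_val).subtype_mk _)
  continuous_invFun := by
    have hv : Continuous fun p : ℝ × {v : Fin 3 → ℝ // v ≠ 0} => p.2.1 :=
      continuous_subtype_val.comp continuous_snd
    have hc : Continuous fun p : ℝ × {v : Fin 3 → ℝ // v ≠ 0} => signedInvNorm ε p.2.1 :=
      continuous_const.mul ((continuous_normSq3.comp hv).sqrt.inv₀
        fun p => (Real.sqrt_pos.mpr (normSq3_pos p.2.2)).ne')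
    exact (continuous_cxMatrix.comp (hc.prodMk (continuous_fst.prodMk hv))).subtype_mk _

/-- For every complex structure `A` on u(2), `(a¹₄)²+(a²₄)²+(a³₄)² ≠ 0` and `c(A) ≠ 0`;
`X4p`, `X4m` are disjoint with union `X4`, each is closed in the matrix space ≅ ℝ¹⁶, and
each is homeomorphic to ℝ × (ℝ³ ∖ {0}). -/
theorem stmt6 :
    (∀ A ∈ X4, (A 0 3) ^ 2 + (A 1 3) ^ 2 + (A 2 3) ^ 2 ≠ 0) ∧
    (∀ A ∈ X4, cmap A ≠ 0) ∧
    X4p ∩ X4m = ∅ ∧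
    X4p ∪ X4m = X4 ∧
    IsClosed X4p ∧
    IsClosed X4m ∧
    Nonempty (↥X4p ≃ₜ ℝ × {v : Fin 3 → ℝ // v ≠ 0}) ∧
    Nonempty (↥X4m ≃ₜ ℝ × {v : Fin 3 → ℝ // v ≠ 0}) := by
  refine ⟨fun A hA => (normSq3_colVec_pos hA).ne', fun A hA => cmap_ne_zero hA, ?_, ?_,
    X4p_eq_signPart ▸ isClosed_signPart one_ne_zero,
    X4m_eq_signPart ▸ isClosed_signPart (neg_ne_zero.mpr one_ne_zero),
    ⟨(Homeomorph.setCongr X4p_eq_signPart).trans (signPartHomeomorph (by norm_num))⟩,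
    ⟨(Homeomorph.setCongr X4m_eq_signPart).trans (signPartHomeomorph (by norm_num))⟩⟩
  · ext A
    simpa [X4p, X4m] using fun _ h _ => h.le
  · ext A
    have := cmap_ne_zero (A := A)
    grind [X4p, X4m]
end
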